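/- Let I be a combinatorial abelian ideal in Φ⁺, let S ⊆ I be a set of pairwise orthogonal roots, and let S′ ⊆ Φ⁺ be any set of pairwise orthogonal positive roots. If ∏_{b∈S} s_b = ∏_{c∈S′} s_c as linear automorphisms of V, and moreover Σ_{b∈S} b∨ = Σ_{c∈S′} c∨ (equality of sums of coroots), then S = S′. -/

import Mathlib

open scoped RealInnerProductSpace

variable {V : Type*} [NormedAddCommGroup V] [InnerProductSpace ℝ V] [FiniteDimensional ℝ V]

/-- The Cartan integer `⟨a, b∨⟩ = 2⟪a,b⟫/⟪b,b⟫`, i.e. the pairing of `a` with the coroot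
of `b`, in a Euclidean realization of the root system. -/
noncomputable def cartan (a b : V) : ℝ := 2 * ⟪a, b⟫ / ⟪b, b⟫

/-- A finite reduced crystallographic root system `Φ` in a Euclidean space `V`,
together with a base `Δ` (the set `simples`); the corresponding positive system `Φ⁺`
consists of the roots that are nonnegative integer combinations of simple roots. -/
structure RootSystemWithBase (V : Type*) [NormedAddCommGroup V] [InnerProductSpace ℝ V] :
    Type _ where
  roots : Set V
  finite : roots.Finite
  ne_zero : ∀ a ∈ roots, a ≠ (0 : V)
  neg_mem : ∀ a ∈ roots, -a ∈ roots
  reduced : ∀ a ∈ roots, ∀ t : ℝ, t • a ∈ roots → t = 1 ∨ t = -1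
  crystal : ∀ a ∈ roots, ∀ b ∈ roots, ∃ n : ℤ, cartan a b = (n : ℝ)
  reflect_mem : ∀ a ∈ roots, ∀ b ∈ roots, a - cartan a b • b ∈ roots
  simples : Set V
  simples_sub : simples ⊆ roots
  indep : LinearIndependent ℝ (fun a : simples => (a : V))
  decomp : ∀ a ∈ roots,
    (∃ c : V →₀ ℕ, ↑c.support ⊆ simples ∧ a = c.sum fun b n => (n : ℝ) • b) ∨
    (∃ c : V →₀ ℕ, ↑c.support ⊆ simples ∧ -a = c.sum fun b n => (n : ℝ) • b)

namespace RootSystemWithBase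

/-- `v` is a nonnegative integer combination of simple roots. -/
def IsNN (R : RootSystemWithBase V) (v : V) : Prop :=
  ∃ c : V →₀ ℕ, ↑c.support ⊆ R.simples ∧ v = c.sum fun b n => (n : ℝ) • b

/-- The set `Φ⁺` of positive roots. -/
def pos (R : RootSystemWithBase V) : Set V :=
  {a ∈ R.roots | R.IsNN a}

/-- A combinatorial abelian ideal in `Φ⁺`: a subset `I ⊆ Φ⁺` such that (i) if `a ∈ I`,
`b ∈ Φ⁺` and `b - a` is a nonnegative integer combination of simple roots then `b ∈ I`,
and (ii) `a + b ∉ Φ` for all `a, b ∈ I`. -/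
def IsAbelianIdeal (R : RootSystemWithBase V) (I : Set V) : Prop :=
  I ⊆ R.pos ∧
  (∀ a ∈ I, ∀ b ∈ R.pos, R.IsNN (b - a) → b ∈ I) ∧
  (∀ a ∈ I, ∀ b ∈ I, a + b ∉ R.roots)

end RootSystemWithBase

/-- The reflection `s_b` associated to a root `b`: `x ↦ x - ⟨x, b∨⟩ b`. -/
noncomputable def reflV (b : V) : V → V := fun x => x - cartan x b • b

/-- The product `σ_S = ∏_{b ∈ S} s_b` of the reflections associated to the elements of a
finite set `S` of roots (for pairwise orthogonal `S` these reflections commute, so the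
product does not depend on the chosen enumeration of `S`). -/
noncomputable def sigmaS (S : Finset V) : V → V :=
  S.toList.foldr (fun b f => reflV b ∘ f) id

/-- The coroot `b∨ = 2b/⟪b,b⟫` of a root `b`, in a Euclidean realization. -/
noncomputable def corootV (b : V) : V := (2 / ⟪b, b⟫) • b

set_option linter.unusedSectionVars false

theorem sum_max_zero {ι : Type*} (A : Finset ι) (g : ι → ℝ) :
    ∑ b ∈ A, max (g b) 0 = ∑ b ∈ A, g b + ∑ b ∈ A, max (-g b) 0 := by
  rw [← Finset.sum_add_distrib]
  refine Finset.sum_congr rfl fun b _ => ?_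
  rcases le_total (g b) 0 with h | h
  · rw [max_eq_right h, max_eq_left (by linarith)]; ring
  · rw [max_eq_left h, max_eq_right (by linarith)]; ring

section Cartan

theorem cartan_add_left (x y b : V) : cartan (x + y) b = cartan x b + cartan y b := by
  simp only [cartan, inner_add_left]; ring

theorem cartan_sub_left (x y b : V) : cartan (x - y) b = cartan x b - cartan y b := by
  simp only [cartan, inner_sub_left]; ring

theorem cartan_smul_left (t : ℝ) (x b : V) : cartan (t • x) b = t * cartan x b := by
  simp only [cartan, real_inner_smul_left]; ring

theorem cartan_sum_smul_left (A : Finset V) (f : V → ℝ) (x : V) :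
    cartan (∑ b ∈ A, f b • b) x = ∑ b ∈ A, f b * cartan b x := by
  simp only [cartan, sum_inner, real_inner_smul_left, Finset.mul_sum, Finset.sum_div]
  exact Finset.sum_congr rfl fun b _ => by ring

theorem cartan_self {b : V} (hb : b ≠ 0) : cartan b b = 2 := by
  have : ⟪b, b⟫ ≠ 0 := inner_self_ne_zero.mpr hb
  rw [cartan]; field_simp

theorem cartan_pos_iff {a b : V} (hb : b ≠ 0) : 0 < cartan a b ↔ 0 < ⟪a, b⟫ := by
  have : 0 < ⟪b, b⟫ := real_inner_self_pos.mpr hb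
  rw [cartan, div_pos_iff_of_pos_right this]
  constructor <;> intro h <;> linarith

theorem cartan_neg_iff {a b : V} (hb : b ≠ 0) : cartan a b < 0 ↔ ⟪a, b⟫ < 0 := by
  have : 0 < ⟪b, b⟫ := real_inner_self_pos.mpr hb
  rw [cartan, div_neg_iff]
  constructor
  · rintro (h | h) <;> linarith
  · intro h; right; constructor <;> linarith

theorem cartan_pos_comm {a b : V} (ha : a ≠ 0) (hb : b ≠ 0) :
    0 < cartan a b ↔ 0 < cartan b a := by
  rw [cartan_pos_iff hb, cartan_pos_iff ha, real_inner_comm]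

theorem cartan_neg_comm {a b : V} (ha : a ≠ 0) (hb : b ≠ 0) :
    cartan a b < 0 ↔ cartan b a < 0 := by
  rw [cartan_neg_iff hb, cartan_neg_iff ha, real_inner_comm]

theorem inner_corootV (x b : V) : ⟪x, corootV b⟫ = cartan x b := by
  rw [corootV, real_inner_smul_right, cartan]; ring

theorem foldr_reflV_apply (l : List V) (hl : l.Pairwise fun a b => cartan b a = 0) (x : V) :
    l.foldr (fun b f => reflV b ∘ f) id x = x - (l.map fun b => cartan x b • b).sum := by
  induction l with
  | nil => simp
  | cons a l ih =>
    rw [List.pairwise_cons] at hl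
    have hz : ∀ l' : List V, (∀ b ∈ l', cartan b a = 0) →
        cartan (l'.map fun b => cartan x b • b).sum a = 0 := by
      intro l' hl'
      induction l' with
      | nil => simp [cartan]
      | cons b l' ih' =>
        rw [List.map_cons, List.sum_cons, cartan_add_left, cartan_smul_left,
          hl' b List.mem_cons_self, ih' fun b' hb' => hl' b' (List.mem_cons_of_mem _ hb')]
        ring
    rw [List.foldr_cons, Function.comp_apply, ih hl.2, reflV, cartan_sub_left, hz l hl.1,
      List.map_cons, List.sum_cons, sub_zero]
    abel

theorem sigmaS_apply (S : Finset V) (hS : ∀ a ∈ S, ∀ b ∈ S, a ≠ b → cartan a b = 0) (x : V) :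
    sigmaS S x = x - ∑ b ∈ S, cartan x b • b := by
  rw [sigmaS, foldr_reflV_apply, Finset.sum_map_toList]
  refine S.nodup_toList.imp_of_mem ?_
  intro a b ha hb hab
  exact hS b (Finset.mem_toList.mp hb) a (Finset.mem_toList.mp ha) hab.symm

theorem sum_cartan_smul_of_mem {S : Finset V}
    (hS : ∀ a ∈ S, ∀ b ∈ S, a ≠ b → cartan a b = 0) {a : V} (ha : a ∈ S) (ha0 : a ≠ 0) :
    ∑ b ∈ S, cartan a b • b = (2 : ℝ) • a := by
  rw [Finset.sum_eq_single_of_mem a ha fun b hb hba => by rw [hS a ha b hb hba.symm, zero_smul],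
    cartan_self ha0]

theorem sum_cartan_of_mem {S : Finset V}
    (hS : ∀ a ∈ S, ∀ b ∈ S, a ≠ b → cartan a b = 0) {a : V} (ha : a ∈ S) (ha0 : a ≠ 0) :
    ∑ b ∈ S, cartan a b = 2 := by
  rw [Finset.sum_eq_single_of_mem a ha fun b hb hba => hS a ha b hb hba.symm, cartan_self ha0]

theorem sum_cartan_eq_of_sum_corootV_eq {A B : Finset V}
    (h : ∑ b ∈ A, corootV b = ∑ c ∈ B, corootV c) (x : V) :
    ∑ b ∈ A, cartan x b = ∑ c ∈ B, cartan x c := by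
  simp only [← inner_corootV, ← inner_sum, h]

/-- If `2x = ∑ ⟨x, b∨⟩ b` then `∑ ⟨x, b∨⟩⟨b, x∨⟩ = 4`. -/
theorem sum_cartan_mul_cartan {A : Finset V} {x : V} (hx : x ≠ 0)
    (h : (2 : ℝ) • x = ∑ b ∈ A, cartan x b • b) :
    ∑ b ∈ A, cartan x b * cartan b x = 4 := by
  rw [← cartan_sum_smul_left, ← h, cartan_smul_left, cartan_self hx]; norm_num

theorem eq_of_two_le_coeff {A : Finset V} {g : V → ℝ} (hg : ∀ b ∈ A, 0 ≤ g b)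
    (hsum : ∑ b ∈ A, g b = 2) {x y : V} (hy : y ∈ A) (hgy : 2 ≤ g y)
    (hx : (2 : ℝ) • x = ∑ b ∈ A, g b • b) : x = y := by
  classical
  have hnn : ∀ b ∈ A.erase y, 0 ≤ g b := fun b hb => hg b (Finset.mem_of_mem_erase hb)
  have hs := Finset.add_sum_erase A g hy
  have hs0 := Finset.sum_nonneg hnn
  have hz := (Finset.sum_eq_zero_iff_of_nonneg hnn).mp (by linarith)
  rw [← Finset.add_sum_erase A _ hy, Finset.sum_eq_zero fun b hb => by rw [hz b hb, zero_smul],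
    add_zero, show g y = 2 by linarith] at hx
  exact smul_right_injective V (two_ne_zero (α := ℝ)) hx

end Cartan

namespace RootSystemWithBase

variable (R : RootSystemWithBase V)

theorem one_le_cartan {a b : V} (ha : a ∈ R.roots) (hb : b ∈ R.roots) (h : 0 < cartan a b) :
    1 ≤ cartan a b := by
  obtain ⟨n, hn⟩ := R.crystal a ha b hb
  rw [hn] at h ⊢
  exact_mod_cast h

theorem cartan_le_neg_one {a b : V} (ha : a ∈ R.roots) (hb : b ∈ R.roots)
    (h : cartan a b < 0) : cartan a b ≤ -1 := by
  obtain ⟨n, hn⟩ := R.crystal a ha b hb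
  rw [hn] at h ⊢
  have : n < 0 := by exact_mod_cast h
  exact_mod_cast (by lia : n ≤ -1)

theorem two_le_cartan {a b : V} (ha : a ∈ R.roots) (hb : b ∈ R.roots)
    (h : 1 < cartan a b) : 2 ≤ cartan a b := by
  obtain ⟨n, hn⟩ := R.crystal a ha b hb
  rw [hn] at h ⊢
  have : 1 < n := by exact_mod_cast h
  exact_mod_cast (by lia : 2 ≤ n)

theorem sub_mem_roots {a b : V} (ha : a ∈ R.roots) (hb : b ∈ R.roots) (hab : a ≠ b)
    (h : 0 < cartan a b) : a - b ∈ R.roots := by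
  have ha0 := R.ne_zero a ha
  have hb0 := R.ne_zero b hb
  have h' := (cartan_pos_comm ha0 hb0).mp h
  rcases (R.one_le_cartan ha hb h).eq_or_lt with h1 | h1
  · simpa [← h1] using R.reflect_mem a ha b hb
  rcases (R.one_le_cartan hb ha h').eq_or_lt with h2 | h2
  · simpa [← h2] using R.neg_mem _ (R.reflect_mem b hb a ha)
  exfalso
  have h1 := R.two_le_cartan ha hb h1
  have h2 := R.two_le_cartan hb ha h2
  rw [cartan, le_div_iff₀ (real_inner_self_pos.mpr hb0)] at h1
  rw [cartan, le_div_iff₀ (real_inner_self_pos.mpr ha0), real_inner_comm a b] at h2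
  have h3 : 0 < ⟪a - b, a - b⟫ := real_inner_self_pos.mpr (sub_ne_zero.mpr hab)
  rw [real_inner_sub_sub_self] at h3
  linarith

theorem add_mem_roots {a b : V} (ha : a ∈ R.roots) (hb : b ∈ R.roots) (hab : a ≠ -b)
    (h : cartan a b < 0) : a + b ∈ R.roots := by
  have h' : 0 < cartan a (-b) := by
    simp only [cartan, inner_neg_right, inner_neg_left, neg_neg] at h ⊢
    rw [mul_neg, neg_div]; linarith
  simpa using R.sub_mem_roots ha (R.neg_mem b hb) hab h'

theorem IsNN.add {R : RootSystemWithBase V} {u v : V} (hu : R.IsNN u) (hv : R.IsNN v) :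
    R.IsNN (u + v) := by
  classical
  obtain ⟨c, hc, rfl⟩ := hu
  obtain ⟨d, hd, rfl⟩ := hv
  refine ⟨c + d, fun x hx => ?_, ?_⟩
  · rcases Finset.mem_union.mp (Finsupp.support_add hx) with h | h
    exacts [hc h, hd h]
  · rw [Finsupp.sum_add_index'] <;> simp [add_smul]

/-- There is a linear functional that is positive on positive roots. -/
theorem exists_height : ∃ h : V →ₗ[ℝ] ℝ, ∀ a ∈ R.pos, 0 < h a := by
  obtain ⟨h, hh⟩ := LinearMap.exists_extend ((Module.Basis.span R.indep).constr ℝ fun _ => (1 : ℝ))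
  have h1 : ∀ b ∈ R.simples, h b = 1 := by
    intro b hb
    have := LinearMap.congr_fun hh (Module.Basis.span R.indep ⟨b, hb⟩)
    rw [Module.Basis.constr_basis] at this
    simpa [Module.Basis.span_apply] using this
  refine ⟨h, fun a ⟨ha, c, hc, hac⟩ => ?_⟩
  have hc0 : c.support.Nonempty := by
    rw [Finset.nonempty_iff_ne_empty, Ne, Finsupp.support_eq_empty]
    rintro rfl
    exact R.ne_zero a ha (by simpa using hac)
  rw [hac, Finsupp.sum, map_sum]
  refine Finset.sum_pos (fun b hb => ?_) hc0
  rw [map_smul, h1 b (hc hb), smul_eq_mul, mul_one, Nat.cast_pos]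
  exact Nat.pos_of_ne_zero (Finsupp.mem_support_iff.mp hb)

theorem height_corootV_pos {f : V →ₗ[ℝ] ℝ} (hf : ∀ a ∈ R.pos, 0 < f a) {a : V} (ha : a ∈ R.pos) :
    0 < f (corootV a) := by
  have h1 : 0 < ⟪a, a⟫ := real_inner_self_pos.mpr (R.ne_zero a ha.1)
  have h2 := hf a ha
  rw [corootV, map_smul, smul_eq_mul]
  positivity

theorem mem_pos_or_neg_mem_pos {a : V} (ha : a ∈ R.roots) : a ∈ R.pos ∨ -a ∈ R.pos :=
  (R.decomp a ha).imp (fun h => ⟨ha, h⟩) fun h => ⟨R.neg_mem a ha, h⟩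

variable {R}

namespace IsAbelianIdeal

variable {I : Set V} (hI : R.IsAbelianIdeal I)

include hI

theorem mem_roots {a : V} (ha : a ∈ I) : a ∈ R.roots := (hI.1 ha).1

theorem add_mem {a p : V} (ha : a ∈ I) (hp : p ∈ R.pos) (hap : a + p ∈ R.roots) : a + p ∈ I :=
  hI.2.1 a ha _ ⟨hap, (hI.1 ha).2.add hp.2⟩ (by simpa using hp.2)

theorem cartan_nonneg {a b : V} (ha : a ∈ I) (hb : b ∈ I) : 0 ≤ cartan a b := by
  by_contra! h
  refine hI.2.2 a ha b hb (R.add_mem_roots (hI.mem_roots ha) (hI.mem_roots hb) ?_ h)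
  rintro rfl
  obtain ⟨f, hf⟩ := R.exists_height
  have h1 := hf _ (hI.1 ha)
  have h2 := hf _ (hI.1 hb)
  rw [map_neg] at h1
  linarith

/-- A root outside an abelian ideal lies below every element of the ideal with which it makes an
acute angle. -/
theorem height_lt {f : V →ₗ[ℝ] ℝ} (hf : ∀ a ∈ R.pos, 0 < f a) {b d : V} (hb : b ∈ I)
    (hd : d ∈ R.roots) (hdI : d ∉ I) (h : 0 < cartan d b) : f d < f b := by
  have hdb : d ≠ b := by rintro rfl; exact hdI hb
  have hroot := R.sub_mem_roots hd (hI.mem_roots hb) hdb h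
  rcases R.mem_pos_or_neg_mem_pos hroot with hp | hp
  · have hbd : b + (d - b) = d := by abel
    exact absurd (hbd ▸ hI.add_mem hb hp (hbd.symm ▸ hd)) hdI
  · have := hf _ hp
    rw [map_neg, map_sub] at this
    linarith

theorem mem_of_cartan_nonneg {A : Finset V} (hA : ↑A ⊆ I) {d : V} (hd : d ∈ R.roots)
    (hnn : ∀ b ∈ A, 0 ≤ cartan d b) (hsum : ∑ b ∈ A, cartan d b = 2)
    (hexp : (2 : ℝ) • d = ∑ b ∈ A, cartan d b • b) : d ∈ I := by
  by_contra hdI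
  obtain ⟨f, hf⟩ := R.exists_height
  have hlt : ∀ b ∈ A, 0 < cartan d b → f d < f b := fun b hb =>
    hI.height_lt hf (hA hb) hd hdI
  obtain ⟨b, hb, hb0⟩ := Finset.exists_lt_of_sum_lt (s := A) (f := fun _ => (0 : ℝ))
    (g := cartan d) (by simp [hsum])
  have : ∑ b ∈ A, cartan d b * f d < ∑ b ∈ A, cartan d b * f b := by
    refine Finset.sum_lt_sum (fun b hb => ?_) ⟨b, hb, mul_lt_mul_of_pos_left (hlt b hb hb0) hb0⟩
    rcases (hnn b hb).eq_or_lt with h | h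
    · simp [← h]
    · exact (mul_lt_mul_of_pos_left (hlt b hb h) h).le
  have h2 := congrArg f hexp
  simp only [map_sum, map_smul, smul_eq_mul] at h2
  rw [← Finset.sum_mul, hsum] at this
  linarith

end IsAbelianIdeal

/-- In an expansion `2x = ∑ ⟨x, b∨⟩ b` with `∑ ⟨x, b∨⟩ = 2`, the negative coefficients add up to at
least `-1`. -/
theorem sum_neg_part_cartan_le_one {A : Finset V} (hA : ↑A ⊆ R.roots) {x : V} (hx : x ∈ R.roots)
    (hsum : ∑ b ∈ A, cartan x b = 2) (hmul : ∑ b ∈ A, cartan x b * cartan b x = 4) :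
    ∑ b ∈ A, max (-cartan x b) 0 ≤ 1 := by
  have hx0 := R.ne_zero x hx
  have key : ∀ b ∈ A, cartan x b + 2 * max (-cartan x b) 0 ≤ cartan x b * cartan b x := by
    intro b hb
    have hbR : b ∈ R.roots := hA hb
    have hb0 := R.ne_zero b hbR
    rcases lt_trichotomy (cartan x b) 0 with h | h | h
    · have h1 := R.cartan_le_neg_one hbR hx ((cartan_neg_comm hx0 hb0).mp h)
      rw [max_eq_left (by linarith)]
      nlinarith
    · simp [h]
    · have h1 := R.one_le_cartan hbR hx ((cartan_pos_comm hx0 hb0).mp h)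
      rw [max_eq_right (by linarith)]
      nlinarith
  have := Finset.sum_le_sum key
  rw [hmul, Finset.sum_add_distrib, ← Finset.mul_sum, hsum] at this
  linarith

/-- A pair of disjoint orthogonal sets of positive roots with the same span and the same sum of
coroots, the first of which lies in `I`. -/
structure IsExchange (R : RootSystemWithBase V) (I : Set V) (A B : Finset V) : Prop where
  subset : ↑A ⊆ I
  subset_pos : ↑B ⊆ R.pos
  disjoint : Disjoint A B
  orth_left : ∀ a ∈ A, ∀ b ∈ A, a ≠ b → cartan a b = 0
  orth_right : ∀ a ∈ B, ∀ b ∈ B, a ≠ b → cartan a b = 0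
  expand_left : ∀ b ∈ A, (2 : ℝ) • b = ∑ c ∈ B, cartan b c • c
  expand_right : ∀ c ∈ B, (2 : ℝ) • c = ∑ b ∈ A, cartan c b • b
  sum_corootV : ∑ b ∈ A, corootV b = ∑ c ∈ B, corootV c

namespace IsExchange

variable {I : Set V} {A B : Finset V} (hI : R.IsAbelianIdeal I) (h : R.IsExchange I A B)

include h

theorem ne {b c : V} (hb : b ∈ A) (hc : c ∈ B) : b ≠ c :=
  fun hbc => Finset.disjoint_left.mp h.disjoint hb (hbc ▸ hc)

theorem right_mem_roots {c : V} (hc : c ∈ B) : c ∈ R.roots := (h.subset_pos hc).1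

theorem right_ne_zero {c : V} (hc : c ∈ B) : c ≠ 0 := R.ne_zero c (h.right_mem_roots hc)

theorem sum_right {c : V} (hc : c ∈ B) : ∑ b ∈ A, cartan c b = 2 := by
  rw [sum_cartan_eq_of_sum_corootV_eq h.sum_corootV,
    sum_cartan_of_mem h.orth_right hc (h.right_ne_zero hc)]

include hI

theorem left_mem_roots {b : V} (hb : b ∈ A) : b ∈ R.roots := hI.mem_roots (h.subset hb)

theorem left_ne_zero {b : V} (hb : b ∈ A) : b ≠ 0 := R.ne_zero b (h.left_mem_roots hI hb)

theorem sum_left {b : V} (hb : b ∈ A) : ∑ c ∈ B, cartan b c = 2 := by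
  rw [← sum_cartan_eq_of_sum_corootV_eq h.sum_corootV,
    sum_cartan_of_mem h.orth_left hb (h.left_ne_zero hI hb)]

theorem neg_part_right {c : V} (hc : c ∈ B) : ∑ b ∈ A, max (-cartan c b) 0 ≤ 1 :=
  sum_neg_part_cartan_le_one (fun _ hb => h.left_mem_roots hI hb) (h.right_mem_roots hc)
    (h.sum_right hc)
    (sum_cartan_mul_cartan (h.right_ne_zero hc) (h.expand_right c hc))

theorem neg_part_left {b : V} (hb : b ∈ A) : ∑ c ∈ B, max (-cartan b c) 0 ≤ 1 :=
  sum_neg_part_cartan_le_one (fun _ hc => h.right_mem_roots hc) (h.left_mem_roots hI hb)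
    (h.sum_left hI hb)
    (sum_cartan_mul_cartan (h.left_ne_zero hI hb) (h.expand_left b hb))

theorem notMem {c : V} (hc : c ∈ B) : c ∉ I := by
  classical
  intro hcI
  have hcR := h.right_mem_roots hc
  have hc0 := h.right_ne_zero hc
  have hn : ∀ b ∈ A, 0 ≤ cartan c b := fun b hb => hI.cartan_nonneg hcI (h.subset hb)
  have hle : ∀ b ∈ A, cartan c b ≤ 1 := by
    intro b hb
    by_contra! hlt
    exact h.ne hb hc (eq_of_two_le_coeff hn (h.sum_right hc) hb
      (R.two_le_cartan hcR (h.left_mem_roots hI hb) hlt) (h.expand_right c hc)).symm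
  have hone : ∀ b ∈ A, 0 < cartan c b → cartan c b = 1 := fun b hb hb' =>
    le_antisymm (hle b hb) (R.one_le_cartan hcR (h.left_mem_roots hI hb) hb')
  obtain ⟨b₁, hb₁, hlt⟩ := Finset.exists_lt_of_sum_lt (s := A) (f := cartan c)
    (g := fun b => cartan c b * cartan b c)
    (by rw [h.sum_right hc, sum_cartan_mul_cartan hc0 (h.expand_right c hc)]; norm_num)
  have hb₁R := h.left_mem_roots hI hb₁
  have hb₁0 := h.left_ne_zero hI hb₁
  have hpos : 0 < cartan c b₁ := by
    refine (hn b₁ hb₁).lt_of_ne fun h0 => ?_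
    simp [← h0] at hlt
  have h1 := hone b₁ hb₁ hpos
  rw [h1, one_mul] at hlt
  obtain ⟨e, he, heneg⟩ : ∃ e ∈ B, cartan b₁ e < 0 := by
    by_contra! hnn
    exact h.ne hb₁ hc (eq_of_two_le_coeff hnn (h.sum_left hI hb₁) hc
      (R.two_le_cartan hb₁R hcR hlt) (h.expand_left b₁ hb₁))
  have heR := h.right_mem_roots he
  have he0 := h.right_ne_zero he
  have hec : e ≠ c := by rintro rfl; linarith
  have hle₁ := R.cartan_le_neg_one heR hb₁R ((cartan_neg_comm hb₁0 he0).mp heneg)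
  have hpart := h.neg_part_right hI he
  have hpart₁ : -cartan e b₁ ≤ 1 := (le_max_left _ 0).trans <|
    (Finset.single_le_sum (f := fun b => max (-cartan e b) 0)
      (fun _ _ => le_max_right _ _) hb₁).trans hpart
  have henn : ∀ b ∈ A, b ≠ b₁ → 0 ≤ cartan e b := by
    intro b hb hbb
    have h2 := (Finset.sum_le_sum_of_subset_of_nonneg (f := fun b => max (-cartan e b) 0)
      (Finset.insert_subset hb₁ (Finset.singleton_subset_iff.mpr hb))
      fun _ _ _ => le_max_right _ _).trans hpart
    rw [Finset.sum_pair hbb.symm] at h2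
    have := le_max_left (-cartan e b₁) 0
    have := le_max_left (-cartan e b) 0
    linarith
  have hroot : b₁ + e ∈ R.roots := by
    refine R.add_mem_roots hb₁R heR ?_ heneg
    rintro hbe
    obtain ⟨f, hf⟩ := R.exists_height
    have h2 := hf _ (hI.1 (h.subset hb₁))
    have h3 := hf _ (h.subset_pos he)
    rw [hbe, map_neg] at h2
    linarith
  have hmem : b₁ + e ∈ I := hI.add_mem (h.subset hb₁) (h.subset_pos he) hroot
  have hsum : ∑ b ∈ A, cartan (b₁ + e) b = 4 := by
    simp only [cartan_add_left, Finset.sum_add_distrib, h.sum_right he,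
      sum_cartan_of_mem h.orth_left hb₁ hb₁0]
    norm_num
  have hne : b₁ + e ≠ c := by
    intro heq
    rw [heq, h.sum_right hc] at hsum
    norm_num at hsum
  have hd : b₁ + e - c ∈ R.roots := by
    refine R.sub_mem_roots hroot hcR hne ?_
    rw [cartan_add_left, h.orth_right e he c hc hec]
    linarith
  refine hI.2.2 _ (hI.mem_of_cartan_nonneg h.subset hd ?_ ?_ ?_) c hcI (by simpa using hroot)
  · intro b hb
    rw [cartan_sub_left, cartan_add_left]
    by_cases hbb : b = b₁
    · subst hbb
      rw [cartan_self hb₁0, h1]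
      linarith
    rw [h.orth_left b₁ hb₁ b hb (Ne.symm hbb), zero_add]
    rcases (hn b hb).eq_or_lt with h0 | h0
    · rw [← h0, sub_zero]
      exact henn b hb hbb
    suffices 0 < cartan e b by
      have := R.one_le_cartan heR (h.left_mem_roots hI hb) this
      linarith [hle b hb]
    refine (henn b hb hbb).lt_of_ne fun hz => ?_
    -- Otherwise `b₁` is the only constituent of `c` not orthogonal to `e`.
    have hdot : ∑ b' ∈ A, cartan c b' * cartan b' e = 0 := by
      rw [← cartan_sum_smul_left, ← h.expand_right c hc, cartan_smul_left,
        h.orth_right c hc e he hec.symm, mul_zero]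
    rw [Finset.sum_eq_single_of_mem b₁ hb₁, h1, one_mul] at hdot
    · exact heneg.ne hdot
    intro b' hb' hbb'
    by_cases hb'b : b' = b
    · subst hb'b
      have hz' : cartan b' e = 0 := by
        have hb0 := h.left_ne_zero hI hb
        have h2 := (cartan_neg_comm he0 hb0).not
        have h3 := (cartan_pos_comm he0 hb0).not
        rw [← hz] at h2 h3
        simp only [lt_irrefl, not_false_eq_true, true_iff, not_lt] at h2 h3
        exact le_antisymm h3 h2
      rw [hz', mul_zero]
    · suffices cartan c b' = 0 by rw [this, zero_mul]
      by_contra hne'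
      have hone' := hone b' hb' ((hn b' hb').lt_of_ne (Ne.symm hne'))
      have hsub : ({b₁, b, b'} : Finset V) ⊆ A := by
        intro y hy
        simp only [Finset.mem_insert, Finset.mem_singleton] at hy
        rcases hy with rfl | rfl | rfl <;> assumption
      have h2 := Finset.sum_le_sum_of_subset_of_nonneg (f := cartan c) hsub
        fun b hb _ => hn b hb
      rw [Finset.sum_insert (by simp [Ne.symm hbb, Ne.symm hbb']),
        Finset.sum_pair (Ne.symm hb'b), h.sum_right hc, h1, hone b hb h0, hone'] at h2
      norm_num at h2
  · simp only [cartan_sub_left, Finset.sum_sub_distrib, hsum, h.sum_right hc]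
    norm_num
  · simp only [cartan_sub_left, cartan_add_left, sub_smul, add_smul, Finset.sum_sub_distrib,
      Finset.sum_add_distrib, smul_sub, smul_add, h.expand_right c hc, h.expand_right e he,
      sum_cartan_smul_of_mem h.orth_left hb₁ hb₁0]

theorem three_le_sum_pos_part {c : V} (hc : c ∈ B) : 3 ≤ ∑ b ∈ A, max (cartan c b) 0 := by
  obtain ⟨b, hb, hneg⟩ : ∃ b ∈ A, cartan c b < 0 := by
    by_contra! hnn
    exact h.notMem hI hc (hI.mem_of_cartan_nonneg h.subset (h.right_mem_roots hc) hnn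
      (h.sum_right hc) (h.expand_right c hc))
  have h1 := R.cartan_le_neg_one (h.right_mem_roots hc) (h.left_mem_roots hI hb) hneg
  have h2 := (le_max_left (-cartan c b) 0).trans
    (Finset.single_le_sum (f := fun b => max (-cartan c b) 0) (fun _ _ => le_max_right _ _) hb)
  rw [sum_max_zero, h.sum_right hc]
  linarith

theorem sum_pos_part_le_three {b : V} (hb : b ∈ A) : ∑ c ∈ B, max (cartan b c) 0 ≤ 3 := by
  have := h.neg_part_left hI hb
  rw [sum_max_zero, h.sum_left hI hb]
  linarith

theorem pos_part_mul_lt {f : V →ₗ[ℝ] ℝ} (hf : ∀ a ∈ R.pos, 0 < f a) {b c : V} (hb : b ∈ A)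
    (hc : c ∈ B) (hpos : 0 < cartan c b) :
    max (cartan c b) 0 * f (corootV c) < max (cartan b c) 0 * f (corootV b) := by
  have hb0 := h.left_ne_zero hI hb
  have hc0 := h.right_ne_zero hc
  have hpos' := (cartan_pos_comm hc0 hb0).mp hpos
  have hlt := hI.height_lt hf (h.subset hb) (h.right_mem_roots hc) (h.notMem hI hc) hpos
  have hcc : 0 < ⟪c, c⟫ := real_inner_self_pos.mpr hc0
  rw [max_eq_left hpos.le, max_eq_left hpos'.le]
  have h1 : cartan c b * f (corootV c) = cartan c b * (2 / ⟪c, c⟫) * f c := by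
    rw [corootV, map_smul, smul_eq_mul, mul_assoc]
  have h2 : cartan b c * f (corootV b) = cartan c b * (2 / ⟪c, c⟫) * f b := by
    rw [corootV, map_smul, smul_eq_mul, cartan, cartan, real_inner_comm c b]
    ring
  rw [h1, h2]
  exact mul_lt_mul_of_pos_left hlt (by positivity)

theorem pos_part_mul_le {f : V →ₗ[ℝ] ℝ} (hf : ∀ a ∈ R.pos, 0 < f a) {b c : V} (hb : b ∈ A)
    (hc : c ∈ B) :
    max (cartan c b) 0 * f (corootV c) ≤ max (cartan b c) 0 * f (corootV b) := by
  rcases lt_or_ge 0 (cartan c b) with hpos | hnp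
  · exact (h.pos_part_mul_lt hI hf hb hc hpos).le
  have hnp' := (cartan_pos_comm (h.right_ne_zero hc) (h.left_ne_zero hI hb)).not.mp hnp.not_gt
  rw [max_eq_right hnp, max_eq_right (not_lt.mp hnp'), zero_mul, zero_mul]

theorem right_eq_empty : B = ∅ := by
  by_contra hB
  obtain ⟨c₀, hc₀⟩ := Finset.nonempty_iff_ne_empty.mpr hB
  obtain ⟨f, hf⟩ := R.exists_height
  obtain ⟨b₀, hb₀, hpos⟩ := Finset.exists_lt_of_sum_lt (s := A) (f := fun _ => (0 : ℝ))
    (g := cartan c₀) (by simp [h.sum_right hc₀])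
  have key : ∑ c ∈ B, ∑ b ∈ A, max (cartan c b) 0 * f (corootV c) <
      ∑ c ∈ B, ∑ b ∈ A, max (cartan b c) 0 * f (corootV b) :=
    Finset.sum_lt_sum
      (fun c hc => Finset.sum_le_sum fun b hb => h.pos_part_mul_le hI hf hb hc)
      ⟨c₀, hc₀, Finset.sum_lt_sum (fun b hb => h.pos_part_mul_le hI hf hb hc₀)
        ⟨b₀, hb₀, h.pos_part_mul_lt hI hf hb₀ hc₀ hpos⟩⟩
  rw [Finset.sum_comm (s := B) (t := A) (f := fun c b => max (cartan b c) 0 * f (corootV b))]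
    at key
  simp only [← Finset.sum_mul] at key
  have hR : ∑ b ∈ A, (∑ c ∈ B, max (cartan b c) 0) * f (corootV b) ≤
      ∑ b ∈ A, 3 * f (corootV b) := Finset.sum_le_sum fun b hb =>
    mul_le_mul_of_nonneg_right (h.sum_pos_part_le_three hI hb)
      (R.height_corootV_pos hf (hI.1 (h.subset hb))).le
  have hL : ∑ c ∈ B, 3 * f (corootV c) ≤
      ∑ c ∈ B, (∑ b ∈ A, max (cartan c b) 0) * f (corootV c) := Finset.sum_le_sum fun c hc =>
    mul_le_mul_of_nonneg_right (h.three_le_sum_pos_part hI hc)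
      (R.height_corootV_pos hf (h.subset_pos hc)).le
  have heq := congrArg f h.sum_corootV
  rw [map_sum, map_sum] at heq
  rw [← Finset.mul_sum] at hL hR
  linarith

theorem left_eq_empty : A = ∅ := by
  by_contra hA
  obtain ⟨b, hb⟩ := Finset.nonempty_iff_ne_empty.mpr hA
  have := h.sum_left hI hb
  simp [h.right_eq_empty hI] at this

end IsExchange

end RootSystemWithBase

theorem sum_sdiff_smul_of_orthogonal [DecidableEq V] {S T : Finset V}
    (hT : ∀ a ∈ T, ∀ b ∈ T, a ≠ b → cartan a b = 0) {c : V} (hc : c ∈ T \ S) :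
    ∑ b ∈ S \ T, cartan c b • b = ∑ b ∈ S, cartan c b • b := by
  rw [Finset.mem_sdiff] at hc
  refine Finset.sum_subset Finset.sdiff_subset fun b hb hb' => ?_
  have hbT : b ∈ T := by
    by_contra hbT
    exact hb' (Finset.mem_sdiff.mpr ⟨hb, hbT⟩)
  rw [hT c hc.1 b hbT (by rintro rfl; exact hc.2 hb), zero_smul]

/-- If `S` is a pairwise orthogonal subset of a combinatorial abelian ideal, `S'` is any
pairwise orthogonal set of positive roots, `∏_{b∈S} s_b = ∏_{c∈S'} s_c` and
`Σ_{b∈S} b∨ = Σ_{c∈S'} c∨`, then `S = S'`. -/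
theorem stmt_5 (R : RootSystemWithBase V) (I : Set V) (hI : R.IsAbelianIdeal I)
    (S S' : Finset V) (hSI : ↑S ⊆ I) (hS' : ↑S' ⊆ R.pos)
    (horthS : ∀ a ∈ S, ∀ b ∈ S, a ≠ b → cartan a b = 0)
    (horthS' : ∀ a ∈ S', ∀ b ∈ S', a ≠ b → cartan a b = 0)
    (heq : sigmaS S = sigmaS S')
    (hcoroots : ∑ b ∈ S, corootV b = ∑ c ∈ S', corootV c) :
    S = S' := by
  classical
  have hS'0 : ∀ c ∈ S', c ≠ 0 := fun c hc => R.ne_zero c (hS' hc).1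
  have hS0 : ∀ b ∈ S, b ≠ 0 := fun b hb => R.ne_zero b (hI.mem_roots (hSI hb))
  have hsum : ∀ x, ∑ b ∈ S, cartan x b • b = ∑ c ∈ S', cartan x c • c := by
    intro x
    have := congrFun heq x
    rwa [sigmaS_apply S horthS, sigmaS_apply S' horthS', sub_right_inj] at this
  have hex : R.IsExchange I (S \ S') (S' \ S) :=
    { subset := fun b hb => hSI (Finset.mem_sdiff.mp hb).1
      subset_pos := fun c hc => hS' (Finset.mem_sdiff.mp hc).1
      disjoint := disjoint_sdiff_sdiff
      orth_left := fun a ha b hb =>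
        horthS a (Finset.mem_sdiff.mp ha).1 b (Finset.mem_sdiff.mp hb).1
      orth_right := fun a ha b hb =>
        horthS' a (Finset.mem_sdiff.mp ha).1 b (Finset.mem_sdiff.mp hb).1
      expand_left := fun b hb => by
        have hbS := (Finset.mem_sdiff.mp hb).1
        rw [sum_sdiff_smul_of_orthogonal horthS hb, ← hsum,
          sum_cartan_smul_of_mem horthS hbS (hS0 b hbS)]
      expand_right := fun c hc => by
        have hcS := (Finset.mem_sdiff.mp hc).1
        rw [sum_sdiff_smul_of_orthogonal horthS' hc, hsum,
          sum_cartan_smul_of_mem horthS' hcS (hS'0 c hcS)]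
      sum_corootV := by
        rw [← Finset.sum_inter_add_sum_sdiff S S', ← Finset.sum_inter_add_sum_sdiff S' S,
          Finset.inter_comm S' S] at hcoroots
        exact add_left_cancel hcoroots }
  exact (Finset.sdiff_eq_empty_iff_subset.mp (hex.left_eq_empty hI)).antisymm
    (Finset.sdiff_eq_empty_iff_subset.mp (hex.right_eq_empty hI))
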